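/- arXiv:2111.03210 — 4 statements merged into one kernel-verified Lean document; each statement's English description precedes it below -/
import Mathlib

section
/- Let F = GF(q) be a finite field, let C be a linear [n,k] MDS code over F, and let L be a positive integer with L ≤ binom(n-1, k-1). If C is strongly-(τ,L)-list decodable for a nonnegative rational τ with (L+1)τ an integer, then τ ≤ L(n-k)/(L+1). -/
/-- The minimum Hamming distance of a linear code `C`, i.e. the minimum
Hamming weight of a nonzero codeword of `C`. -/
noncomputable def minHammingDist {F : Type*} [Field F] [DecidableEq F]
    {ι : Type*} [Fintype ι] (C : Submodule F (ι → F)) : ℕ :=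
  sInf {w : ℕ | ∃ c ∈ C, c ≠ 0 ∧ hammingNorm c = w}

/-- A linear code of dimension `k` in `F^ι` is MDS if its minimum Hamming
distance equals `n - k + 1`, where `n = |ι|`. -/
noncomputable def IsMDSCode {F : Type*} [Field F] [DecidableEq F]
    {ι : Type*} [Fintype ι] (k : ℕ) (C : Submodule F (ι → F)) : Prop :=
  minHammingDist C = Fintype.card ι - k + 1

/-- A linear code `C ⊆ F^ι` is strongly `(τ,L)`-list decodable if there are no
`L+1` distinct vectors in the same coset of `C` whose Hamming weights sum to at
most `(L+1)τ`. -/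
def StronglyListDecodable {F : Type*} [Field F] [DecidableEq F]
    {ι : Type*} [Fintype ι] (C : Submodule F (ι → F)) (τ : ℚ) (L : ℕ) : Prop :=
  ¬∃ e : Fin (L + 1) → (ι → F), Function.Injective e ∧
      (∀ m m', e m - e m' ∈ C) ∧
      (∑ m, (hammingNorm (e m) : ℚ)) ≤ ((L : ℚ) + 1) * τ

/-- A nonzero codeword of an MDS code vanishes on fewer than `k` coordinates. -/
theorem IsMDSCode.card_lt_of_vanishing {F : Type*} [Field F] [DecidableEq F]
    {ι : Type*} [Fintype ι] [DecidableEq ι] {k : ℕ} {C : Submodule F (ι → F)}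
    (hC : IsMDSCode k C) (hk : k ≤ Fintype.card ι) {c : ι → F} (hc : c ∈ C) (hc0 : c ≠ 0)
    {J : Finset ι} (hJ : ∀ i ∈ J, c i = 0) : J.card < k := by
  have hw : Fintype.card ι - k + 1 ≤ hammingNorm c :=
    hC ▸ Nat.sInf_le ⟨c, hc, hc0, rfl⟩
  have hle : hammingNorm c ≤ Jᶜ.card := by
    refine Finset.card_le_card fun i hi => ?_
    rw [Finset.mem_compl]
    intro h
    exact (Finset.mem_filter.1 hi).2 (hJ i h)
  rw [Finset.card_compl] at hle
  have := J.card_le_univ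
  omega

/-- Any `k` coordinates of a `k`-dimensional MDS code form an information set. -/
theorem IsMDSCode.exists_codeword_eq_on {F : Type*} [Field F] [DecidableEq F]
    {ι : Type*} [Fintype ι] [DecidableEq ι] {k : ℕ} {C : Submodule F (ι → F)}
    (hC : IsMDSCode k C) (hdim : Module.finrank F C = k) (hk : k ≤ Fintype.card ι)
    {J : Finset ι} (hJ : J.card = k) (v : ι → F) : ∃ c ∈ C, ∀ i ∈ J, c i = v i := by
  let φ : C →ₗ[F] (J → F) := (LinearMap.funLeft F F ((↑) : J → ι)).comp C.subtype
  have hinj : Function.Injective φ := by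
    rw [injective_iff_map_eq_zero]
    intro c hc
    by_contra hne
    refine (hC.card_lt_of_vanishing hk c.2 (fun h => hne (Subtype.ext h)) (J := J) ?_).ne hJ
    exact fun i hi => congrFun hc ⟨i, hi⟩
  have hsurj : Function.Surjective φ := by
    rwa [← LinearMap.injective_iff_surjective_of_finrank_eq_finrank]
    simp [hdim, hJ]
  obtain ⟨c, hc⟩ := hsurj fun i => v i
  exact ⟨c, c.2, fun i hi => congrFun hc ⟨i, hi⟩⟩

/-- An MDS code of positive dimension has `L + 1` distinct vectors in one coset, one of weight
one and the others of weight at most `n - k`, provided that `L ≤ (n - 1).choose (k - 1)`. -/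
theorem IsMDSCode.exists_coset_vectors {F : Type*} [Field F] [DecidableEq F]
    {ι : Type*} [Fintype ι] [DecidableEq ι] {k L : ℕ} {C : Submodule F (ι → F)}
    (hC : IsMDSCode k C) (hdim : Module.finrank F C = k) (hk0 : 0 < k)
    (hk : k ≤ Fintype.card ι) (hL : L ≤ (Fintype.card ι - 1).choose (k - 1)) :
    ∃ e : Fin (L + 1) → (ι → F), Function.Injective e ∧ (∀ m m', e m - e m' ∈ C) ∧
      ∑ m, hammingNorm (e m) ≤ 1 + L * (Fintype.card ι - k) := by
  obtain ⟨i₀⟩ : Nonempty ι := Fintype.card_pos_iff.1 (hk0.trans_le hk)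
  let S : Finset (Finset ι) := (Finset.univ.erase i₀).powersetCard (k - 1)
  have hS : S.card = (Fintype.card ι - 1).choose (k - 1) := by
    simp [S, Finset.card_powersetCard, Finset.card_erase_of_mem]
  obtain ⟨f⟩ : Nonempty (Fin L ↪ S) :=
    Function.Embedding.nonempty_of_card_le (by simpa [hS] using hL)
  have hi₀ (m : Fin L) : i₀ ∉ (f m).1 := fun h => by
    simpa using (Finset.mem_powersetCard.1 (f m).2).1 h
  have hf (m : Fin L) : (f m).1.card = k - 1 := (Finset.mem_powersetCard.1 (f m).2).2
  have hins (m : Fin L) : (insert i₀ (f m).1).card = k := by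
    rw [Finset.card_insert_of_notMem (hi₀ m), hf m]
    omega
  let δ : ι → F := Pi.single i₀ 1
  choose c hcC hc using fun m => hC.exists_codeword_eq_on hdim hk (hins m) (-δ)
  have hci (m : Fin L) : c m i₀ = -1 := by simpa [δ] using hc m i₀ (by simp)
  have hc0 (m : Fin L) (i : ι) (hi : i ∈ (f m).1) : c m i = 0 := by
    have hne : i ≠ i₀ := fun h => hi₀ m (h ▸ hi)
    simpa [δ, hne] using hc m i (by simp [hi])
  have hcinj : Function.Injective c := by
    intro m m' h
    have hlt := hC.card_lt_of_vanishing hk (hcC m) (J := (f m).1 ∪ (f m').1)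
      (fun h0 => by simpa [h0] using hci m) (fun i hi => by
        rcases Finset.mem_union.1 hi with hi | hi
        · exact hc0 m i hi
        · exact h ▸ hc0 m' i hi)
    have h₁ : (f m).1 = (f m).1 ∪ (f m').1 :=
      Finset.eq_of_subset_of_card_le Finset.subset_union_left (by rw [hf]; omega)
    have h₂ : (f m').1 = (f m).1 ∪ (f m').1 :=
      Finset.eq_of_subset_of_card_le Finset.subset_union_right (by rw [hf]; omega)
    exact f.injective (Subtype.ext (h₁.trans h₂.symm))
  refine ⟨fun m => δ + Fin.cons (α := fun _ => ι → F) 0 c m, ?_, ?_, ?_⟩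
  · refine (add_right_injective δ).comp (Fin.cons_injective_iff.2 ⟨?_, hcinj⟩)
    rintro ⟨m, hm⟩
    simpa [hm] using hci m
  · have hmem (m : Fin (L + 1)) : Fin.cons (α := fun _ => ι → F) 0 c m ∈ C :=
      Fin.cases (by simp) (fun i => by simpa using hcC i) m
    intro m m'
    rw [add_sub_add_left_eq_sub]
    exact C.sub_mem (hmem m) (hmem m')
  · rw [Fin.sum_univ_succ]
    simp only [Fin.cons_zero, Fin.cons_succ, add_zero]
    refine add_le_add ?_ ?_
    · refine (Finset.card_le_card (t := {i₀}) fun i hi => ?_).trans (by simp)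
      by_contra h
      exact (Finset.mem_filter.1 hi).2 (Pi.single_eq_of_ne (by simpa using h) _)
    · refine (Finset.sum_le_card_nsmul _ _ (Fintype.card ι - k) fun m _ => ?_).trans (by simp)
      rw [← hins m, ← Finset.card_compl]
      refine Finset.card_le_card fun i hi => ?_
      rw [Finset.mem_compl]
      intro h
      exact (Finset.mem_filter.1 hi).2 (by simp [hc m i h])

/-- An MDS code has positive dimension. -/
theorem IsMDSCode.pos_of_finrank_eq {F : Type*} [Field F] [DecidableEq F]
    {ι : Type*} [Fintype ι] {k : ℕ} {C : Submodule F (ι → F)}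
    (hC : IsMDSCode k C) (hdim : Module.finrank F C = k) : 0 < k := by
  rw [Nat.pos_iff_ne_zero]
  rintro rfl
  have hbot : C = ⊥ := Submodule.finrank_eq_zero.1 hdim
  have hempty : {w : ℕ | ∃ c ∈ C, c ≠ 0 ∧ hammingNorm c = w} = ∅ := by
    ext w
    simp +contextual [hbot]
  rw [IsMDSCode, minHammingDist, hempty, Nat.sInf_empty] at hC
  omega

/-- Theorem `stronglySingletonImproved`: a linear `[n,k]` MDS
code over `GF(q)` with `L ≤ C(n-1, k-1)` is strongly `(τ,L)`-list decodable
(for a nonnegative rational `τ` with `(L+1)τ ∈ ℤ`) only if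
`τ ≤ L(n-k)/(L+1)`. -/
theorem stmt4 {F : Type*} [Field F] [Fintype F] [DecidableEq F]
    {n k L : ℕ} (τ : ℚ) (C : Submodule F (Fin n → F))
    (hk : Module.finrank F C = k) (hkn : k ≤ n)
    (hMDS : IsMDSCode k C)
    (hL : 1 ≤ L) (hLub : L ≤ (n - 1).choose (k - 1))
    (hτ0 : 0 ≤ τ) (hτint : ∃ z : ℤ, ((L : ℚ) + 1) * τ = (z : ℚ))
    (hsdec : StronglyListDecodable C τ L) :
    τ ≤ ((L : ℚ) * ((n - k : ℕ) : ℚ)) / ((L : ℚ) + 1) := by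
  obtain ⟨z, hz⟩ := hτint
  by_contra! hlt
  rw [div_lt_iff₀ (by positivity), mul_comm τ, hz] at hlt
  have hz' : (L : ℤ) * ((n - k : ℕ) : ℤ) + 1 ≤ z := by
    rw [Int.add_one_le_iff]
    exact_mod_cast hlt
  obtain ⟨e, hinj, hcoset, hsum⟩ := hMDS.exists_coset_vectors hk
    (hMDS.pos_of_finrank_eq hk) (by simpa using hkn) (by simpa using hLub)
  refine hsdec ⟨e, hinj, hcoset, ?_⟩
  rw [Fintype.card_fin] at hsum
  rw [hz]
  have hsum' : ((∑ m, hammingNorm (e m) : ℕ) : ℤ) ≤ z := by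
    refine le_trans (Int.ofNat_le.2 hsum) ?_
    push_cast
    linarith
  exact_mod_cast hsum'
end

section
/- Let F = GF(q) be a finite field and let C be a linear [n,k] MDS code over F. Then C is 2-MDS if and only if for every integer w in the range max{0, n-2k} ≤ w ≤ n-k-3 and every subset J of the coordinate set [n] with |J| = w, the linear [n-w, k] code obtained by puncturing C on the coordinates in J is lightly-2-MDS. -/
/-- A linear code `C ⊆ F^ι` of dimension `k` is `L`-MDS if there are no `L+1`
distinct vectors in the same coset of `C` whose Hamming weights sum to at most
`L(n-k)`, where `n = |ι|`. -/
def IsLMDS {F : Type*} [Field F] [DecidableEq F]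
    {ι : Type*} [Fintype ι] (k L : ℕ) (C : Submodule F (ι → F)) : Prop :=
  ¬∃ e : Fin (L + 1) → (ι → F), Function.Injective e ∧
      (∀ m m', e m - e m' ∈ C) ∧
      (∑ m, hammingNorm (e m)) ≤ L * (Fintype.card ι - k)

/-- A linear code `C ⊆ F^ι` of dimension `k` and minimum distance `d` is
lightly `L`-MDS if there are no `L+1` nonzero vectors, each of Hamming weight
at most `d - 1`, lying in the same coset of `C`, having pairwise disjoint
supports, and whose Hamming weights sum to at most `L(n-k)`. -/
noncomputable def IsLightlyLMDS {F : Type*} [Field F] [DecidableEq F]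
    {ι : Type*} [Fintype ι] (k L : ℕ) (C : Submodule F (ι → F)) : Prop :=
  ¬∃ e : Fin (L + 1) → (ι → F),
      (∀ m, e m ≠ 0) ∧
      (∀ m, hammingNorm (e m) ≤ minHammingDist C - 1) ∧
      (∀ m m', e m - e m' ∈ C) ∧
      (Pairwise fun m m' =>
        Disjoint (Function.support (e m)) (Function.support (e m'))) ∧
      (∑ m, hammingNorm (e m)) ≤ L * (Fintype.card ι - k)

/-- The puncturing of a code `C ⊆ F^n` on a subset `J` of coordinates: the
restriction of the codewords to the coordinates outside `J`. -/
def punctureCode {F : Type*} [Field F] {n : ℕ}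
    (C : Submodule F (Fin n → F)) (J : Finset (Fin n)) :
    Submodule F ({x : Fin n // x ∈ Jᶜ} → F) :=
  C.map (LinearMap.funLeft F F (fun i : {x : Fin n // x ∈ Jᶜ} => (i : Fin n)))

theorem hammingNorm_eq_sum_ite {F : Type*} [Field F] [DecidableEq F] {ι : Type*} [Fintype ι]
    (x : ι → F) : hammingNorm x = ∑ i, if x i ≠ 0 then 1 else 0 := by
  rw [hammingNorm, Finset.card_filter]

theorem hammingNorm_restrict {F : Type*} [Field F] [DecidableEq F] {n : ℕ}
    (J : Finset (Fin n)) (x : Fin n → F) :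
    hammingNorm (fun i : {i : Fin n // i ∈ Jᶜ} => x i) =
      ∑ i ∈ Jᶜ, if x i ≠ 0 then 1 else 0 := by
  rw [hammingNorm_eq_sum_ite]
  exact Finset.sum_coe_sort Jᶜ (fun i => if x i ≠ 0 then 1 else 0)

theorem hammingNorm_eq_restrict_add {F : Type*} [Field F] [DecidableEq F] {n : ℕ}
    (J : Finset (Fin n)) (x : Fin n → F) :
    hammingNorm x = hammingNorm (fun i : {i : Fin n // i ∈ Jᶜ} => x i) +
      ∑ i ∈ J, if x i ≠ 0 then 1 else 0 := by
  rw [hammingNorm_restrict, hammingNorm_eq_sum_ite, add_comm, Finset.sum_add_sum_compl]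

theorem hammingNorm_le_restrict_add_card {F : Type*} [Field F] [DecidableEq F] {n : ℕ}
    (J : Finset (Fin n)) (x : Fin n → F) :
    hammingNorm x ≤ hammingNorm (fun i : {i : Fin n // i ∈ Jᶜ} => x i) + J.card := by
  rw [hammingNorm_eq_restrict_add J x]
  refine Nat.add_le_add_left ?_ _
  rw [Finset.card_eq_sum_ones]
  exact Finset.sum_le_sum fun i _ => by split_ifs <;> simp

theorem hammingNorm_sub_le_add {F : Type*} [Field F] [DecidableEq F] {ι : Type*} [Fintype ι]
    (x y : ι → F) : hammingNorm (x - y) ≤ hammingNorm x + hammingNorm y := by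
  simp only [hammingNorm_eq_sum_ite, ← Finset.sum_add_distrib]
  refine Finset.sum_le_sum fun i _ => ?_
  by_cases hx : x i = 0 <;> by_cases hy : y i = 0 <;> simp [hx, hy]
  split_ifs <;> simp

theorem minHammingDist_le {F : Type*} [Field F] [DecidableEq F] {ι : Type*} [Fintype ι]
    {C : Submodule F (ι → F)} {c : ι → F} (hc : c ∈ C) (h0 : c ≠ 0) :
    minHammingDist C ≤ hammingNorm c :=
  Nat.sInf_le ⟨c, hc, h0, rfl⟩

/-- Puncturing on `J` lowers the minimum distance by at most `J.card`, as long as it does not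
exhaust it. -/
theorem minHammingDist_le_punctureCode_add {F : Type*} [Field F] [DecidableEq F] {n : ℕ}
    {C : Submodule F (Fin n → F)} {J : Finset (Fin n)} (hJ : J.card < minHammingDist C) :
    minHammingDist C ≤ minHammingDist (punctureCode C J) + J.card := by
  have hne : {w : ℕ | ∃ c ∈ C, c ≠ 0 ∧ hammingNorm c = w}.Nonempty := by
    by_contra h
    rw [Set.not_nonempty_iff_eq_empty] at h
    rw [minHammingDist, h] at hJ
    simp at hJ
  obtain ⟨_, c, hc, hc0, rfl⟩ := hne
  have hne' : {w : ℕ | ∃ c ∈ punctureCode C J, c ≠ 0 ∧ hammingNorm c = w}.Nonempty := by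
    refine ⟨_, _, Submodule.mem_map_of_mem hc, ?_, rfl⟩
    have h1 := minHammingDist_le hc hc0
    have h2 := hammingNorm_le_restrict_add_card J c
    refine hammingNorm_pos_iff.mp ?_
    change 0 < hammingNorm (fun i : {i : Fin n // i ∈ Jᶜ} => c i)
    omega
  obtain ⟨c', ⟨b, hb, rfl⟩, hc'0, hw⟩ := Nat.sInf_mem hne'
  have hb0 : b ≠ 0 := by
    rintro rfl
    exact hc'0 (map_zero _)
  have h1 := minHammingDist_le hb hb0
  have h2 := hammingNorm_le_restrict_add_card J b
  have h3 : hammingNorm (fun i : {i : Fin n // i ∈ Jᶜ} => b i) =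
    minHammingDist (punctureCode C J) := hw
  omega

/-- Vectors with pairwise disjoint supports in one coset of a punctured code lift to the
original code, gaining weight at most `2 * J.card` in total. -/
theorem isLightlyLMDS_punctureCode {F : Type*} [Field F] [DecidableEq F] {n k : ℕ}
    {C : Submodule F (Fin n → F)} (h : IsLMDS k 2 C) {J : Finset (Fin n)}
    (hJ : J.card + k ≤ n) : IsLightlyLMDS k 2 (punctureCode C J) := by
  rintro ⟨e, hne, -, hC, hdisj, hsum⟩
  have hex : ∀ m, ∃ c ∈ C, (∀ i : {i : Fin n // i ∈ Jᶜ}, c i = e m i - e 0 i) ∧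
      (m = 0 → c = 0) := by
    intro m
    by_cases hm : m = 0
    · exact ⟨0, C.zero_mem, by simp [hm], fun _ => rfl⟩
    · obtain ⟨c, hc, hce⟩ := hC m 0
      exact ⟨c, hc, fun i => congrFun hce i, fun h => absurd h hm⟩
  choose c hcC hce hc0 using hex
  let b : Fin n → F := fun i => if hi : i ∈ Jᶜ then e 0 ⟨i, hi⟩ else 0
  have hres : ∀ m, (fun i : {i : Fin n // i ∈ Jᶜ} => (b + c m) i) = e m := by
    intro m
    funext i
    have hb : b i = e 0 i := dif_pos i.2
    simp [Pi.add_apply, hb, hce]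
  refine h ⟨fun m => b + c m, ?_, ?_, ?_⟩
  · intro m m' hmm
    by_contra hne'
    have hee : e m = e m' := by
      rw [← hres m, ← hres m']
      exact congrArg (fun x (i : {i : Fin n // i ∈ Jᶜ}) => x i) hmm
    have hd : Disjoint (Function.support (e m)) (Function.support (e m')) := hdisj hne'
    rw [hee, disjoint_self] at hd
    exact hne m' (Function.support_eq_empty_iff.mp hd)
  · intro m m'
    rw [add_sub_add_left_eq_sub]
    exact C.sub_mem (hcC m) (hcC m')
  · have h0 : hammingNorm (b + c 0) = hammingNorm (e 0) := by
      rw [hammingNorm_eq_restrict_add J, hres, hc0 0 rfl]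
      simp only [Nat.add_eq_left]
      refine Finset.sum_eq_zero fun i hi => ?_
      simp [b, hi]
    have h1 := hammingNorm_le_restrict_add_card J (b + c 1)
    have h2 := hammingNorm_le_restrict_add_card J (b + c 2)
    rw [hres] at h1 h2
    change ∑ m : Fin 3, hammingNorm (e m) ≤ _ at hsum
    change ∑ m : Fin 3, hammingNorm (b + c m) ≤ _
    simp only [Fin.sum_univ_three, Fintype.card_coe, Finset.card_compl, Fintype.card_fin]
      at hsum ⊢
    omega

/-- Three vectors in a coset can be translated, by their coordinatewise majority value, so that
their supports are disjoint off the set of coordinates where they take three distinct values. -/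
theorem exists_translate_disjoint_support {F : Type*} [Field F] [DecidableEq F] {n : ℕ}
    (e : Fin 3 → Fin n → F) :
    ∃ (J : Finset (Fin n)) (v : Fin n → F),
      (∀ i ∉ J, ∀ m m', m ≠ m' → e m i = v i ∨ e m' i = v i) ∧
      ∑ m, hammingNorm (fun i : {i : Fin n // i ∈ Jᶜ} => (e m - v) i) + 2 * J.card ≤
        ∑ m, hammingNorm (e m) := by
  refine ⟨Finset.univ.filter fun i => e 0 i ≠ e 1 i ∧ e 0 i ≠ e 2 i ∧ e 1 i ≠ e 2 i,
    fun i => if e 0 i = e 1 i then e 0 i else e 2 i, ?_, ?_⟩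
  · intro i hi m m' hm
    simp only [Finset.mem_filter, Finset.mem_univ, true_and] at hi
    fin_cases m <;> fin_cases m' <;> simp at hm ⊢ <;> grind
  · generalize hJ : Finset.univ.filter
      (fun i => e 0 i ≠ e 1 i ∧ e 0 i ≠ e 2 i ∧ e 1 i ≠ e 2 i) = J
    have hmem : ∀ i, i ∈ J ↔ e 0 i ≠ e 1 i ∧ e 0 i ≠ e 2 i ∧ e 1 i ≠ e 2 i := by
      simp [← hJ]
    have hleft : ∑ i ∈ J, 2 ≤ ∑ i ∈ J, ∑ m, if e m i ≠ 0 then 1 else 0 := by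
      refine Finset.sum_le_sum fun i hi => ?_
      rw [hmem] at hi
      rw [Fin.sum_univ_three]
      grind
    have hright : ∑ i ∈ Jᶜ, ∑ m, (if (e m - fun i =>
          if e 0 i = e 1 i then e 0 i else e 2 i) i ≠ 0 then 1 else 0) ≤
        ∑ i ∈ Jᶜ, ∑ m, if e m i ≠ 0 then 1 else 0 := by
      refine Finset.sum_le_sum fun i hi => ?_
      rw [Finset.mem_compl, hmem] at hi
      simp only [Fin.sum_univ_three, Pi.sub_apply, sub_ne_zero]
      grind
    simp only [hammingNorm_restrict]
    simp only [hammingNorm_eq_sum_ite]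
    rw [Finset.sum_comm, Finset.sum_comm (s := Finset.univ) (t := Finset.univ),
      ← Finset.sum_add_sum_compl J]
    rw [Finset.sum_const, smul_eq_mul] at hleft
    omega

/-- A violation of the `2`-MDS property yields a violation of the lightly `2`-MDS property for
some puncturing. -/
theorem isLMDS_of_forall_punctureCode {F : Type*} [Field F] [DecidableEq F] {n k : ℕ}
    {C : Submodule F (Fin n → F)} (hkn : k ≤ n) (hMDS : IsMDSCode k C)
    (h : ∀ w : ℕ, n ≤ 2 * k + w → w + k + 3 ≤ n → ∀ J : Finset (Fin n), J.card = w →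
      IsLightlyLMDS k 2 (punctureCode C J)) : IsLMDS k 2 C := by
  rintro ⟨e, hinj, hC, hsum⟩
  obtain ⟨J₀, v, hv, hJ₀⟩ := exists_translate_disjoint_support e
  have hcard₀ : J₀.card ≤ n := by simpa using J₀.card_le_univ
  obtain ⟨J, hsub, -, hJ⟩ := Finset.exists_subsuperset_card_eq (Finset.subset_univ J₀)
    (n := max J₀.card (n - 2 * k)) (le_max_left _ _) (by simp; omega)
  let f : Fin 3 → {i : Fin n // i ∈ Jᶜ} → F := fun m i => (e m - v) i
  have hdisj : Pairwise fun m m' =>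
      Disjoint (Function.support (f m)) (Function.support (f m')) := by
    intro m m' hm
    rw [Set.disjoint_left]
    intro i hi hi'
    have hiJ : (i : Fin n) ∉ J₀ := fun hh => (Finset.mem_compl.mp i.2) (hsub hh)
    rcases hv i hiJ m m' hm with h1 | h1
    · exact hi (by simp [f, h1])
    · exact hi' (by simp [f, h1])
  have hpair : ∀ m m', m ≠ m' →
      n - k + 1 ≤ hammingNorm (f m) + hammingNorm (f m') + J.card := by
    intro m m' hm
    have h1 := minHammingDist_le (hC m m') (sub_ne_zero.mpr (hinj.ne hm))
    rw [hMDS, Fintype.card_fin] at h1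
    have h2 := hammingNorm_le_restrict_add_card J (e m - e m')
    have h3 := hammingNorm_sub_le_add (f m) (f m')
    have h4 : (fun i : {i : Fin n // i ∈ Jᶜ} => (e m - e m') i) = f m - f m' := by
      funext i
      simp [f]
    rw [h4] at h2
    omega
  have hf : hammingNorm (f 0) + hammingNorm (f 1) + hammingNorm (f 2) ≤
      ∑ m : Fin 3, hammingNorm (fun i : {i : Fin n // i ∈ J₀ᶜ} => (e m - v) i) := by
    rw [Fin.sum_univ_three]
    simp only [f, hammingNorm_restrict]
    have hs := Finset.compl_subset_compl.mpr hsub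
    gcongr
  have hcard : hammingNorm (f 0) + hammingNorm (f 1) + hammingNorm (f 2) ≤ n - J.card := by
    simp only [hammingNorm_eq_sum_ite, ← Finset.sum_add_distrib]
    calc _ ≤ ∑ _i : {i : Fin n // i ∈ Jᶜ}, 1 := by
          refine Finset.sum_le_sum fun i _ => ?_
          have hd : ∀ m m', m ≠ m' → f m i = 0 ∨ f m' i = 0 := by
            intro m m' hm
            by_contra! hh
            exact Set.disjoint_left.mp (hdisj hm) hh.1 hh.2
          have h01 := hd 0 1 (by decide)
          have h02 := hd 0 2 (by decide)
          have h12 := hd 1 2 (by decide)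
          grind
      _ = n - J.card := by simp [Finset.card_compl]
  change ∑ m : Fin 3, hammingNorm (e m) ≤ _ at hsum
  rw [Fintype.card_fin] at hsum
  have h01 := hpair 0 1 (by decide)
  have h02 := hpair 0 2 (by decide)
  have h12 := hpair 1 2 (by decide)
  have htot : hammingNorm (f 0) + hammingNorm (f 1) + hammingNorm (f 2) + 2 * J.card ≤
      2 * (n - k) := by
    rcases max_cases J₀.card (n - 2 * k) with hm | hm <;> omega
  have hdist := minHammingDist_le_punctureCode_add (C := C) (J := J) (by
    rw [hMDS, Fintype.card_fin]
    omega)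
  rw [hMDS, Fintype.card_fin] at hdist
  refine h J.card (by omega) (by omega) J rfl ⟨f, ?_, ?_, ?_, hdisj, ?_⟩
  · intro m
    refine hammingNorm_pos_iff.mp ?_
    fin_cases m <;> simp only [Fin.zero_eta, Fin.mk_one, Fin.reduceFinMk] <;> omega
  · intro m
    fin_cases m <;> simp only [Fin.zero_eta, Fin.mk_one, Fin.reduceFinMk] <;> omega
  · intro m m'
    refine ⟨e m - e m', hC m m', ?_⟩
    funext i
    simp [f, LinearMap.funLeft_apply]
  · change ∑ m : Fin 3, hammingNorm (f m) ≤ _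
    simp only [Fin.sum_univ_three, Fintype.card_coe, Finset.card_compl, Fintype.card_fin]
    omega

/-- Theorem `puncturingL=2`: a linear `[n,k]` MDS code `C` is
`2`-MDS if and only if for every `w` with `max{0, n-2k} ≤ w ≤ n-k-3` and every
`w`-subset `J` of the coordinates, the `[n-w, k]` code obtained by puncturing
`C` on `J` is lightly `2`-MDS. -/
theorem stmt8 {F : Type*} [Field F] [Fintype F] [DecidableEq F]
    {n k : ℕ} (C : Submodule F (Fin n → F))
    (hk : Module.finrank F C = k)
    (hMDS : IsMDSCode k C) :
    IsLMDS k 2 C ↔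
      ∀ w : ℕ, n ≤ 2 * k + w → w + k + 3 ≤ n →
        ∀ J : Finset (Fin n), J.card = w →
          IsLightlyLMDS k 2 (punctureCode C J) := by
  have hkn : k ≤ n := by
    simpa [hk] using Submodule.finrank_le C
  exact ⟨fun h w _ hw J hJ => isLightlyLMDS_punctureCode h (by omega),
    isLMDS_of_forall_punctureCode hkn hMDS⟩
end

section
/- There exists a constant c > 0 such that for every prime power q, every positive integer n, and every k ∈ {1, ..., n}, the number of linear [n,k] codes over F = GF(q) that are not 2-MDS is at most c · (5^n / q) times the total number of linear [n,k] codes over F (i.e., all but a fraction O(5^n/q) of the k-dimensional subspaces of F^n are 2-MDS codes). -/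
open Finset Module

theorem LinearIndependent.exists_linearEquiv_apply_eq {K V ι : Type*} [Field K] [AddCommGroup V]
    [Module K V] [Finite ι] {v w : ι → V} (hv : LinearIndependent K v)
    (hw : LinearIndependent K w) : ∃ g : V ≃ₗ[K] V, ∀ i, g (v i) = w i := by
  have : FiniteDimensional K (Submodule.span K (Set.range v)) :=
    FiniteDimensional.span_of_finite K (Set.finite_range v)
  let f := hv.linearCombinationEquiv.symm.trans hw.linearCombinationEquiv
  obtain ⟨g, hg⟩ := Submodule.exists_linearEquiv_restrict_eq f
  refine ⟨g, fun i => ?_⟩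
  have h := hg (hv.linearCombinationEquiv (Finsupp.single i 1))
  simpa [f] using h.symm

section Counting

open scoped Classical

variable {F V : Type*} [Field F] [AddCommGroup V] [Module F V]

theorem card_submodule_containing_eq [Fintype (Submodule F V)] {ι : Type*} [Finite ι]
    {v w : ι → V}
    (hv : LinearIndependent F v) (hw : LinearIndependent F w) (k : ℕ) :
    #{C : Submodule F V | finrank F C = k ∧ ∀ i, v i ∈ C} =
      #{C : Submodule F V | finrank F C = k ∧ ∀ i, w i ∈ C} := by
  obtain ⟨g, hg⟩ := hv.exists_linearEquiv_apply_eq hw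
  refine card_equiv (Submodule.orderIsoMapComap g).toEquiv fun C => ?_
  have h1 : finrank F (C.map (g : V →ₗ[F] V)) = finrank F C := g.finrank_map_eq C
  have h2 (i) : w i ∈ C.map (g : V →ₗ[F] V) ↔ v i ∈ C := by
    rw [← hg i]
    simp
  simp only [mem_filter, mem_univ, true_and]
  change _ ↔ finrank F (C.map (g : V →ₗ[F] V)) = k ∧ ∀ i, w i ∈ C.map (g : V →ₗ[F] V)
  simp only [h1, h2]

variable [Fintype F] [Fintype V]

/-- The number of linearly independent `m`-tuples of vectors of a subspace. -/
theorem card_linearIndependent_mem_submodule (C : Submodule F V) (m : ℕ) :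
    #{v : Fin m → V | LinearIndependent F v ∧ ∀ i, v i ∈ C} =
      if m ≤ finrank F C then
        ∏ i : Fin m, (Fintype.card F ^ finrank F C - Fintype.card F ^ i.val) else 0 := by
  split_ifs with h
  · rw [← card_linearIndependent h, ← Fintype.card_subtype, ← Nat.card_eq_fintype_card]
    refine Nat.card_congr
      { toFun := fun v => ⟨fun i => ⟨v.1 i, v.2.2 i⟩, ?_⟩
        invFun := fun s => ⟨fun i => s.1 i, ?_, fun i => (s.1 i).2⟩
        left_inv := fun _ => rfl
        right_inv := fun _ => rfl }
    · exact LinearIndependent.of_comp C.subtype v.2.1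
    · exact s.2.map' C.subtype C.ker_subtype
  · rw [card_eq_zero, filter_eq_empty_iff]
    rintro v - ⟨hv, hC⟩
    have : LinearIndependent F (fun i => (⟨v i, hC i⟩ : C)) :=
      LinearIndependent.of_comp C.subtype hv
    exact h (by simpa using this.fintype_card_le_finrank)

variable [Fintype (Submodule F V)]

theorem card_submodule_containing_mul_pow_le {m : ℕ} {v : Fin m → V}
    (hv : LinearIndependent F v) {k : ℕ} (hk : k ≤ finrank F V) :
    #{C : Submodule F V | finrank F C = k ∧ ∀ i, v i ∈ C} *
        Fintype.card F ^ (m * (finrank F V - k)) ≤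
      #{C : Submodule F V | finrank F C = k} := by
  set q := Fintype.card F
  set n := finrank F V
  set M := #{C : Submodule F V | finrank F C = k ∧ ∀ i, v i ∈ C}
  set N := #{C : Submodule F V | finrank F C = k}
  have hq : 1 < q := Fintype.one_lt_card
  have hm : m ≤ n := by simpa using hv.fintype_card_le_finrank
  set P := ∏ i : Fin m, (q ^ n - q ^ i.val) with hP
  set L := if m ≤ k then ∏ i : Fin m, (q ^ k - q ^ i.val) else 0 with hL
  have hcount : M * P = N * L := by
    have h := sum_card_bipartiteAbove_eq_sum_card_bipartiteBelow
      (s := ({v : Fin m → V | LinearIndependent F v} : Finset _))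
      (t := ({C : Submodule F V | finrank F C = k} : Finset _)) (fun v C => ∀ i, v i ∈ C)
    simp only [bipartiteAbove, bipartiteBelow, filter_filter] at h
    rw [sum_const_nat (m := M), sum_const_nat (m := L)] at h
    · rw [← h, mul_comm, ← Fintype.card_subtype, ← Nat.card_eq_fintype_card,
        card_linearIndependent hm]
    · intro C hC
      rw [card_linearIndependent_mem_submodule, (mem_filter.1 hC).2]
    · intro w hw
      convert card_submodule_containing_eq (mem_filter.1 hw).2 hv k
  have hPpos : 0 < P := prod_pos fun i _ =>
    Nat.sub_pos_of_lt (Nat.pow_lt_pow_right hq (i.2.trans_le hm))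
  have hLP : L * q ^ (m * (n - k)) ≤ P := by
    rw [hL]
    split_ifs
    · rw [mul_comm m, pow_mul, hP]
      have : (q ^ (n - k)) ^ m = ∏ _i : Fin m, q ^ (n - k) := by simp
      rw [this, ← prod_mul_distrib]
      refine prod_le_prod' fun i _ => ?_
      rw [Nat.sub_mul, ← pow_add, Nat.add_sub_cancel' hk]
      exact Nat.sub_le_sub_left (Nat.le_mul_of_pos_right _ (by positivity)) _
    · simp
  refine Nat.le_of_mul_le_mul_right ?_ hPpos
  calc M * q ^ (m * (n - k)) * P = N * (L * q ^ (m * (n - k))) := by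
        rw [mul_right_comm, hcount, mul_assoc]
    _ ≤ N * P := Nat.mul_le_mul_left _ hLP

/-- A first moment bound: the scaling action of `Fˣ` turns one tuple in a subspace into
`q - 1` of them. -/
theorem card_mul_card_sub_one_le_of_forall_exists_tuple {m : ℕ} [NeZero m] {k K : ℕ}
    (hk : k ≤ finrank F V) (T : Finset (Fin m → V)) (hT : ∀ v ∈ T, LinearIndependent F v)
    (hsmul : ∀ v ∈ T, ∀ a : F, a ≠ 0 → a • v ∈ T)
    (hcard : #T ≤ K * Fintype.card F ^ (m * (finrank F V - k)))
    (B : Finset (Submodule F V)) (hB : ∀ C ∈ B, finrank F C = k)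
    (hBT : ∀ C ∈ B, ∃ v ∈ T, ∀ i, v i ∈ C) :
    #B * (Fintype.card F - 1) ≤ K * #{C : Submodule F V | finrank F C = k} := by
  set q := Fintype.card F
  set N := #{C : Submodule F V | finrank F C = k}
  set Q := q ^ (m * (finrank F V - k))
  have hQ : 0 < Q := pow_pos Fintype.card_pos _
  have hlow : #B * (q - 1) ≤ ∑ C ∈ B, #(T.bipartiteAbove (fun C v => ∀ i, v i ∈ C) C) := by
    rw [← smul_eq_mul]
    refine card_nsmul_le_sum _ _ _ fun C hC => ?_
    obtain ⟨v, hvT, hvC⟩ := hBT C hC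
    have hq : q - 1 = #(univ.erase (0 : F)) := by rw [card_erase_of_mem (mem_univ _), card_univ]
    rw [hq]
    refine card_le_card_of_injOn (fun a => a • v) (fun a ha => ?_) fun a _ b _ hab => ?_
    · exact mem_coe.2 <| mem_filter.2
        ⟨hsmul v hvT a (ne_of_mem_erase ha), fun i => C.smul_mem a (hvC i)⟩
    · exact smul_left_injective F ((hT v hvT).ne_zero 0) (congrFun hab 0)
  rw [sum_card_bipartiteAbove_eq_sum_card_bipartiteBelow] at hlow
  refine Nat.le_of_mul_le_mul_right ?_ hQ
  calc #B * (q - 1) * Q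
      ≤ (∑ v ∈ T, #(B.bipartiteBelow (fun C v => ∀ i, v i ∈ C) v)) * Q :=
        Nat.mul_le_mul_right _ hlow
    _ = ∑ v ∈ T, #(B.bipartiteBelow (fun C v => ∀ i, v i ∈ C) v) * Q := sum_mul ..
    _ ≤ ∑ _v ∈ T, N := sum_le_sum fun v hv => by
        refine le_trans (Nat.mul_le_mul_right _ (card_le_card fun C hC => ?_))
          (card_submodule_containing_mul_pow_le (hT v hv) hk)
        obtain ⟨hC, hvC⟩ := (mem_bipartiteBelow _).1 hC
        simpa using ⟨hB C hC, hvC⟩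
    _ = #T * N := by simp
    _ ≤ K * N * Q := by
        rw [mul_right_comm]
        exact Nat.mul_le_mul_right _ hcard

theorem card_filter_exists_pattern_le {ι X P : Type*} [Fintype ι] [Fintype X]
    [Fintype P] {q : ℕ} (hq : 0 < q) (cost : P → ℕ) (Z : P → Finset X)
    (hZ : ∀ p, #(Z p) ≤ q ^ cost p) (s : ℕ) :
    #{f : ι → X | ∃ π : ι → P, (∀ i, f i ∈ Z (π i)) ∧ ∑ i, cost (π i) ≤ s} ≤
      Fintype.card P ^ Fintype.card ι * q ^ s := by
  calc _ ≤ #(({π : ι → P | ∑ i, cost (π i) ≤ s} : Finset _).biUnion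
          fun π => Fintype.piFinset fun i => Z (π i)) := by
        refine card_le_card fun f hf => ?_
        obtain ⟨π, h1, h2⟩ := (mem_filter.1 hf).2
        exact mem_biUnion.2 ⟨π, by simpa using h2, Fintype.mem_piFinset.2 h1⟩
    _ ≤ #({π : ι → P | ∑ i, cost (π i) ≤ s} : Finset _) * q ^ s := by
        refine card_biUnion_le_card_mul _ _ _ fun π hπ => ?_
        rw [Fintype.card_piFinset]
        calc ∏ i, #(Z (π i)) ≤ ∏ i, q ^ cost (π i) := prod_le_prod' fun i _ => hZ _
          _ = q ^ ∑ i, cost (π i) := prod_pow_eq_pow_sum ..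
          _ ≤ q ^ s := Nat.pow_le_pow_right hq (mem_filter.1 hπ).2
    _ ≤ _ := by
        refine Nat.mul_le_mul_right _ ((card_le_univ _).trans ?_)
        simp

theorem card_mul_card_sub_one_le_of_forall_exists_pattern {ι P : Type*} [Fintype ι] [Fintype P]
    [Fintype (Submodule F (ι → F))] {m : ℕ} [NeZero m] {k : ℕ} (hk : k ≤ Fintype.card ι)
    (cost : P → ℕ) (Z : P → Finset (Fin m → F))
    (hZ : ∀ p, #(Z p) ≤ Fintype.card F ^ cost p) (hsmul : ∀ p, ∀ x ∈ Z p, ∀ a : F, a • x ∈ Z p)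
    (B : Finset (Submodule F (ι → F))) (hB : ∀ C ∈ B, finrank F C = k)
    (hpat : ∀ C ∈ B, ∃ v : Fin m → ι → F, LinearIndependent F v ∧ (∀ j, v j ∈ C) ∧
      ∃ π : ι → P, (∀ i, (fun j => v j i) ∈ Z (π i)) ∧
        ∑ i, cost (π i) ≤ m * (Fintype.card ι - k)) :
    #B * (Fintype.card F - 1) ≤ Fintype.card P ^ Fintype.card ι *
      #{C : Submodule F (ι → F) | finrank F C = k} := by
  have hrank : finrank F (ι → F) = Fintype.card ι := finrank_fintype_fun_eq_card F
  refine card_mul_card_sub_one_le_of_forall_exists_tuple (m := m) (hk.trans_eq hrank.symm)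
    {v : Fin m → ι → F | LinearIndependent F v ∧ ∃ π : ι → P,
      (∀ i, (fun j => v j i) ∈ Z (π i)) ∧ ∑ i, cost (π i) ≤ m * (Fintype.card ι - k)}
    (fun v hv => (mem_filter.1 hv).2.1) ?_ ?_ B hB ?_
  · intro v hv a ha
    obtain ⟨-, hli, π, h1, h2⟩ := mem_filter.1 hv
    refine mem_filter.2 ⟨mem_univ _, ?_, π, fun i => hsmul _ _ (h1 i) a, h2⟩
    exact hli.units_smul fun _ => Units.mk0 a ha
  · rw [hrank]
    refine le_trans ?_ (card_filter_exists_pattern_le (ι := ι) Fintype.card_pos cost Z hZ _)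
    refine card_le_card_of_injOn (fun v i j => v j i) (fun v hv => ?_) fun v _ w _ h => ?_
    · simp only [coe_filter, mem_univ, true_and, Set.mem_ofPred_eq] at hv ⊢
      exact hv.2
    · funext j i
      exact congrFun (congrFun h i) j
  · intro C hC
    obtain ⟨v, hli, hvC, hπ⟩ := hpat C hC
    exact ⟨v, mem_filter.2 ⟨mem_univ _, hli, hπ⟩, hvC⟩

/-- Few subspaces contain a nonzero vector of weight at most `n - k`. -/
theorem card_exists_hammingNorm_le_mul_le {ι : Type*} [Fintype ι]
    [Fintype (Submodule F (ι → F))] {k : ℕ} (hk : k ≤ Fintype.card ι) :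
    #{C : Submodule F (ι → F) | finrank F C = k ∧
        ∃ u ∈ C, u ≠ 0 ∧ hammingNorm u ≤ Fintype.card ι - k} * (Fintype.card F - 1) ≤
      2 ^ Fintype.card ι * #{C : Submodule F (ι → F) | finrank F C = k} := by
  refine card_mul_card_sub_one_le_of_forall_exists_pattern (m := 1) (P := Bool) hk
    (fun b => if b then 1 else 0) (fun b => if b then univ else {0}) ?_ ?_ _
    (fun C hC => (mem_filter.1 hC).2.1) ?_
  · rintro (_ | _) <;> simp
  · rintro (_ | _) <;> simp
  · intro C hC
    obtain ⟨-, -, u, huC, hu, hw⟩ := mem_filter.1 hC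
    refine ⟨fun _ => u, ?_, fun _ => huC, fun i => decide (u i ≠ 0), fun i => ?_, ?_⟩
    · rw [linearIndependent_unique_iff]
      exact hu
    · by_cases h : u i = 0
      · simp [h, funext_iff]
      · simp [h]
    · simpa [hammingNorm, card_filter] using hw

/-- The pairs `(a, b)` such that `(0, a, b)` obeys a given pattern of coincidences. -/
noncomputable def coincidencePairs (F : Type*) [Field F] [Fintype F] :
    Fin 5 → Finset (Fin 2 → F) :=
  ![{![0, 0]}, univ.image fun t => ![0, t], univ.image fun t => ![t, 0],
    univ.image fun t => ![t, t], univ]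

/-- Few subspaces contain two independent vectors whose pattern of coincidences is cheap. -/
theorem card_exists_coincidencePairs_mul_le {ι : Type*} [Fintype ι]
    [Fintype (Submodule F (ι → F))] {k : ℕ} (hk : k ≤ Fintype.card ι) :
    #{C : Submodule F (ι → F) | finrank F C = k ∧
        ∃ v : Fin 2 → ι → F, LinearIndependent F v ∧ (∀ j, v j ∈ C) ∧
          ∃ π : ι → Fin 5, (∀ i, (fun j => v j i) ∈ coincidencePairs F (π i)) ∧
            ∑ i, (![0, 1, 1, 1, 2] : Fin 5 → ℕ) (π i) ≤ 2 * (Fintype.card ι - k)} *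
          (Fintype.card F - 1) ≤
      5 ^ Fintype.card ι * #{C : Submodule F (ι → F) | finrank F C = k} := by
  refine card_mul_card_sub_one_le_of_forall_exists_pattern (m := 2) (P := Fin 5) hk
    ![0, 1, 1, 1, 2] (coincidencePairs F) ?_ ?_ _
    (fun C hC => (mem_filter.1 hC).2.1) (fun C hC => (mem_filter.1 hC).2.2)
  · intro p
    fin_cases p
    · simp [coincidencePairs]
    · simpa [coincidencePairs] using card_image_le (s := univ) (f := fun t : F => ![0, t])
    · simpa [coincidencePairs] using card_image_le (s := univ) (f := fun t : F => ![t, 0])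
    · simpa [coincidencePairs] using card_image_le (s := univ) (f := fun t : F => ![t, t])
    · simp [coincidencePairs]
  · intro p
    fin_cases p <;> simp [coincidencePairs]

end Counting

theorem exists_coincidencePairs_cost_le {F : Type*} [Field F] [Fintype F] [DecidableEq F]
    (x y z : F) :
    ∃ p : Fin 5, ![y - x, z - x] ∈ coincidencePairs F p ∧
      (![0, 1, 1, 1, 2] : Fin 5 → ℕ) p ≤
        (if x ≠ 0 then 1 else 0) + (if y ≠ 0 then 1 else 0) + (if z ≠ 0 then 1 else 0) := by
  by_cases hxy : y = x
  · by_cases hxz : z = x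
    · exact ⟨0, by simp [coincidencePairs, hxy, hxz], by simp⟩
    · refine ⟨1, by simp [coincidencePairs, hxy], ?_⟩
      simp only [Matrix.cons_val]
      grind
  · by_cases hxz : z = x
    · refine ⟨2, by simp [coincidencePairs, hxz], ?_⟩
      simp only [Matrix.cons_val]
      grind
    · by_cases hyz : y = z
      · refine ⟨3, by simp [coincidencePairs, hyz], ?_⟩
        simp only [Matrix.cons_val]
        grind
      · refine ⟨4, by simp [coincidencePairs], ?_⟩
        simp only [Matrix.cons_val]
        grind

theorem sum_hammingNorm_eq_sum {F ι : Type*} [Field F] [DecidableEq F] [Fintype ι]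
    (e : Fin 3 → ι → F) :
    ∑ m, hammingNorm (e m) = ∑ i, ((if e 0 i ≠ 0 then 1 else 0) + (if e 1 i ≠ 0 then 1 else 0) +
      (if e 2 i ≠ 0 then 1 else 0)) := by
  simp only [Fin.sum_univ_three, hammingNorm, card_filter, sum_add_distrib]

theorem two_mul_hammingNorm_sub_le {F ι : Type*} [Field F] [DecidableEq F] [Fintype ι]
    (e : Fin 3 → ι → F) {a : F} (ha0 : a ≠ 0) (ha1 : a ≠ 1)
    (ha : a • (e 1 - e 0) = e 2 - e 0) :
    2 * hammingNorm (e 1 - e 0) ≤ ∑ m, hammingNorm (e m) := by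
  rw [sum_hammingNorm_eq_sum, hammingNorm, card_filter, mul_sum]
  refine sum_le_sum fun i _ => ?_
  have hi : a * (e 1 i - e 0 i) = e 2 i - e 0 i := congrFun ha i
  have h1 : e 1 i ≠ e 0 i → e 2 i ≠ e 0 i := fun h h' =>
    mul_ne_zero ha0 (sub_ne_zero.2 h) (by rw [hi, h', sub_self])
  have h2 : e 1 i ≠ e 0 i → e 2 i ≠ e 1 i := fun h h' => by
    rw [h'] at hi
    exact ha1 (mul_right_cancel₀ (sub_ne_zero.2 h) (by rw [hi, one_mul]))
  simp only [Pi.sub_apply, sub_ne_zero]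
  grind

theorem exists_of_not_isLMDS_two {F ι : Type*} [Field F] [Fintype F] [DecidableEq F] [Fintype ι]
    {k : ℕ} {C : Submodule F (ι → F)} (h : ¬ IsLMDS k 2 C) :
    (∃ u ∈ C, u ≠ 0 ∧ hammingNorm u ≤ Fintype.card ι - k) ∨
      ∃ v : Fin 2 → ι → F, LinearIndependent F v ∧ (∀ j, v j ∈ C) ∧
        ∃ π : ι → Fin 5, (∀ i, (fun j => v j i) ∈ coincidencePairs F (π i)) ∧
          ∑ i, (![0, 1, 1, 1, 2] : Fin 5 → ℕ) (π i) ≤ 2 * (Fintype.card ι - k) := by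
  obtain ⟨e, hinj, hC, hw⟩ := not_not.1 h
  change ∑ m : Fin 3, hammingNorm (e m) ≤ _ at hw
  have hne {i j : Fin 3} (hij : i ≠ j) : e i - e j ≠ 0 := sub_ne_zero.2 (hinj.ne hij)
  by_cases hli : LinearIndependent F ![e 1 - e 0, e 2 - e 0]
  · right
    choose π hπ hcost using fun i => exists_coincidencePairs_cost_le (e 0 i) (e 1 i) (e 2 i)
    refine ⟨_, hli, ?_, π, fun i => ?_, ?_⟩
    · intro j
      fin_cases j
      · exact hC 1 0
      · exact hC 2 0
    · convert hπ i using 1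
      funext j
      fin_cases j <;> simp
    · refine le_trans (sum_le_sum fun i _ => hcost i) ?_
      rwa [← sum_hammingNorm_eq_sum]
  · left
    rw [LinearIndependent.pair_iff' (hne (by decide))] at hli
    push Not at hli
    obtain ⟨a, ha⟩ := hli
    refine ⟨e 1 - e 0, hC 1 0, hne (by decide), ?_⟩
    have ha0 : a ≠ 0 := by
      rintro rfl
      exact hne (i := 2) (j := 0) (by decide) (by rw [← ha, zero_smul])
    have ha1 : a ≠ 1 := by
      rintro rfl
      rw [one_smul, sub_left_inj] at ha
      exact absurd (hinj ha) (by decide)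
    have := two_mul_hammingNorm_sub_le e ha0 ha1 ha
    omega

open scoped Classical in
theorem card_not_isLMDS_two_mul_le {F ι : Type*} [Field F] [Fintype F] [DecidableEq F]
    [Fintype ι] [Fintype (Submodule F (ι → F))] {k : ℕ} (hk : k ≤ Fintype.card ι) :
    #{C : Submodule F (ι → F) | finrank F C = k ∧ ¬ IsLMDS k 2 C} * (Fintype.card F - 1) ≤
      (2 ^ Fintype.card ι + 5 ^ Fintype.card ι) *
        #{C : Submodule F (ι → F) | finrank F C = k} := by
  rw [add_mul]
  refine le_trans ?_ (add_le_add (card_exists_hammingNorm_le_mul_le hk)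
    (card_exists_coincidencePairs_mul_le hk))
  rw [← add_mul]
  refine Nat.mul_le_mul_right _ (le_trans (card_le_card fun C hC => ?_) (card_union_le _ _))
  simp only [mem_union, mem_filter, mem_univ, true_and] at hC ⊢
  refine (exists_of_not_isLMDS_two hC.2).imp (fun h => ⟨hC.1, ?_⟩) fun h => ⟨hC.1, h⟩
  convert h

/-- Theorem `almostall2-MDS`: there is an absolute constant
`c > 0` such that for every finite field `F` of size `q`, every `n` and every
`k ∈ {1, …, n}`, the number of `k`-dimensional subspaces of `F^n` that are not
`2`-MDS is at most `c ⬝ (5^n / q)` times the total number of `k`-dimensional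
subspaces of `F^n`. -/
theorem stmt10 :
    ∃ c : ℝ, 0 < c ∧
      ∀ (F : Type) [Field F] [Fintype F] [DecidableEq F] (n k : ℕ),
        1 ≤ k → k ≤ n →
        (Nat.card {C : Submodule F (Fin n → F) //
            Module.finrank F C = k ∧ ¬ IsLMDS k 2 C} : ℝ) ≤
          c * ((5 : ℝ) ^ n / (Fintype.card F : ℝ)) *
            (Nat.card {C : Submodule F (Fin n → F) //
              Module.finrank F C = k} : ℝ) := by
  classical
  refine ⟨4, by norm_num, fun F _ _ _ n k _ hk => ?_⟩
  have := Fintype.ofFinite (Submodule F (Fin n → F))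
  rw [Nat.card_eq_fintype_card, Nat.card_eq_fintype_card, Fintype.card_subtype,
    Fintype.card_subtype]
  have h := card_not_isLMDS_two_mul_le (F := F) (ι := Fin n) (k := k) (by simpa using hk)
  rw [Fintype.card_fin] at h
  set B := #{C : Submodule F (Fin n → F) | finrank F C = k ∧ ¬ IsLMDS k 2 C}
  set N := #{C : Submodule F (Fin n → F) | finrank F C = k}
  have hq : 2 ≤ Fintype.card F := Fintype.one_lt_card
  have h25 : 2 ^ n ≤ 5 ^ n := Nat.pow_le_pow_left (by norm_num) n
  have key : B * Fintype.card F ≤ 4 * 5 ^ n * N := by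
    calc B * Fintype.card F ≤ B * (2 * (Fintype.card F - 1)) :=
          Nat.mul_le_mul_left _ (by omega)
      _ = 2 * (B * (Fintype.card F - 1)) := by ring
      _ ≤ 2 * ((5 ^ n + 5 ^ n) * N) :=
          Nat.mul_le_mul_left _ (h.trans (Nat.mul_le_mul_right _ (Nat.add_le_add_right h25 _)))
      _ = 4 * 5 ^ n * N := by ring
  have hq0 : (0 : ℝ) < Fintype.card F := by positivity
  rw [← mul_div_assoc, div_mul_eq_mul_div, le_div_iff₀ hq0]
  exact_mod_cast key
end

section
/- Fix a real ε ∈ (0, 1/2]. Let F = GF(q) be a finite field, let C ⊆ F^n be a (not necessarily linear) code of rate R = (log_q |C|)/n with R ∈ [ε, 1-ε], let L be a positive integer with L < (1/√(2n)) · 2^{η_q(ε)·n}, and let τ be a nonnegative integer with τ ≥ L·n·(1-R)/(L+1). If C is (τ,L)-list decodable, then L < q - 1. -/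
/-- A code `C ⊆ F^ι` is `(τ, L)`-list decodable if every Hamming ball of
radius `τ` contains at most `L` codewords. -/
def ListDecodable {F : Type*} [Field F] [DecidableEq F]
    {ι : Type*} [Fintype ι] (C : Set (ι → F)) (τ L : ℕ) : Prop :=
  ∀ y : ι → F, ({c | c ∈ C ∧ hammingDist y c ≤ τ}).ncard ≤ L

/-- The binary entropy function `h(x) = -x log₂ x - (1-x) log₂ (1-x)`
(with `h(0) = h(1) = 0`). -/
noncomputable def binEnt (x : ℝ) : ℝ :=
  -x * Real.logb 2 x - (1 - x) * Real.logb 2 (1 - x)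

/-- The function `η_q(ε) = h((q-1)/q · (1-ε)) - (1-ε) · h(1/q)`. -/
noncomputable def etaQ (q : ℕ) (ε : ℝ) : ℝ :=
  binEnt (((q : ℝ) - 1) / (q : ℝ) * (1 - ε)) - (1 - ε) * binEnt (1 / (q : ℝ))

theorem card_filter_ne_eq {F ι : Type*} [Fintype F] [DecidableEq F] [Fintype ι] [DecidableEq ι]
    (c : ι → F) (S : Finset ι) :
    (Finset.univ.filter fun y : ι → F => Finset.univ.filter (fun i => y i ≠ c i) = S).card =
      (Fintype.card F - 1) ^ S.card := by
  have h : (Finset.univ.filter fun y : ι → F => Finset.univ.filter (fun i => y i ≠ c i) = S) =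
      Fintype.piFinset fun i => if i ∈ S then Finset.univ.erase (c i) else {c i} := by
    ext y
    simp only [Finset.mem_filter, Finset.mem_univ, true_and, Fintype.mem_piFinset, Finset.ext_iff]
    refine forall_congr' fun i => ?_
    by_cases hi : i ∈ S <;> simp [hi]
  rw [h, Fintype.card_piFinset]
  simp [apply_ite Finset.card]

theorem card_hammingDist_eq {F ι : Type*} [Fintype F] [DecidableEq F] [Fintype ι] [DecidableEq ι]
    (c : ι → F) (t : ℕ) :
    (Finset.univ.filter fun y : ι → F => hammingDist y c = t).card =
      (Fintype.card ι).choose t * (Fintype.card F - 1) ^ t := by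
  rw [Finset.card_eq_sum_card_fiberwise (f := fun y => Finset.univ.filter fun i => y i ≠ c i)
    (t := Finset.powersetCard t Finset.univ)
    (fun y hy => by simpa [Finset.mem_powersetCard, hammingDist] using hy),
    Finset.sum_congr rfl (g := fun _ => (Fintype.card F - 1) ^ t)]
  · simp [Finset.card_powersetCard]
  · intro S hS
    rw [Finset.mem_powersetCard_univ] at hS
    subst hS
    rw [← card_filter_ne_eq c S, Finset.filter_filter]
    congr 1
    refine Finset.filter_congr fun y _ => ⟨fun h => h.2, fun h => ⟨?_, h⟩⟩
    rw [← h, hammingDist]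

/-- The number of words of a Hamming ball of radius `t` in `F^n`, where `F` has `q` elements. -/
def hammingBallCard (q n t : ℕ) : ℕ := ∑ i ∈ Finset.range (t + 1), n.choose i * (q - 1) ^ i

theorem card_hammingDist_le {F ι : Type*} [Fintype F] [DecidableEq F] [Fintype ι] [DecidableEq ι]
    (c : ι → F) (t : ℕ) :
    (Finset.univ.filter fun y : ι → F => hammingDist y c ≤ t).card =
      hammingBallCard (Fintype.card F) (Fintype.card ι) t := by
  rw [Finset.card_eq_sum_card_fiberwise (f := fun y => hammingDist y c)
    (t := Finset.range (t + 1)) (fun y hy => by simpa [Nat.lt_succ_iff] using hy),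
    hammingBallCard]
  refine Finset.sum_congr rfl fun i hi => ?_
  rw [Finset.mem_range, Nat.lt_succ_iff] at hi
  have := card_hammingDist_eq c i
  rw [← this, Finset.filter_filter]
  congr 1
  exact Finset.filter_congr fun y _ => ⟨fun h => h.2, fun h => ⟨h.trans_le hi, h⟩⟩

theorem hammingBallCard_mono (q n : ℕ) : Monotone (hammingBallCard q n) := fun _ _ h =>
  Finset.sum_le_sum_of_subset (Finset.range_mono (Nat.succ_le_succ h))

theorem choose_mul_le_hammingBallCard (q n t : ℕ) :
    n.choose t * (q - 1) ^ t ≤ hammingBallCard q n t :=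
  Finset.single_le_sum (f := fun i => n.choose i * (q - 1) ^ i) (fun _ _ => Nat.zero_le _)
    (Finset.self_mem_range_succ t)

theorem hammingBallCard_self {q : ℕ} (hq : 1 ≤ q) (n : ℕ) : hammingBallCard q n n = q ^ n := by
  obtain ⟨r, rfl⟩ := Nat.exists_eq_add_of_le' hq
  rw [add_pow, hammingBallCard]
  exact Finset.sum_congr rfl fun i _ => by simp [mul_comm]

theorem succ_pow_le_pow_mul_sqrt {m : ℕ} (hm : 1 ≤ m) :
    ((m : ℝ) + 1) ^ m ≤ (m : ℝ) ^ m * √(2 * (m + 1)) := by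
  obtain rfl | rfl | h3 : m = 1 ∨ m = 2 ∨ 3 ≤ m := by omega
  · norm_num
  · have : (9 / 4 : ℝ) ≤ √(2 * ((2 : ℕ) + 1)) := Real.le_sqrt_of_sq_le (by norm_num)
    norm_num at this ⊢
    linarith
  · have hm0 : (0 : ℝ) < m := by positivity
    have h1 : ((m : ℝ) + 1) ^ m = (m : ℝ) ^ m * (1 / m + 1) ^ m := by
      rw [← mul_pow]
      congr 1
      field_simp
      rw [add_comm]
    rw [h1]
    gcongr
    calc (1 / (m : ℝ) + 1) ^ m ≤ (Real.exp (1 / m)) ^ m := by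
          gcongr
          exact Real.add_one_le_exp _
      _ = Real.exp 1 := by
          rw [← Real.exp_nat_mul]
          congr 1
          field_simp
      _ ≤ _ := by
          refine Real.le_sqrt_of_sq_le ?_
          have h3' : (3 : ℝ) ≤ m := by exact_mod_cast h3
          have := Real.exp_one_lt_d9
          have := Real.exp_pos 1
          nlinarith

theorem stirlingSeq_mul_le {n k m : ℕ} (hn : n ≠ 0) (hk : 2 ≤ k) (hm : 2 ≤ m) :
    Stirling.stirlingSeq k * Stirling.stirlingSeq m ≤ 2 * Stirling.stirlingSeq n := by
  have h2 : Stirling.stirlingSeq 2 = Real.exp 1 ^ 2 / 4 := by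
    rw [Stirling.stirlingSeq]
    have : √(2 * ((2 : ℕ) : ℝ)) = 2 := by
      rw [show (2 * ((2 : ℕ) : ℝ)) = 2 ^ 2 by norm_num]
      simp
    rw [this]
    have := Real.exp_pos 1
    norm_num [Nat.factorial]
    field_simp
    norm_num
    ring
  have key : ∀ j, 2 ≤ j → Stirling.stirlingSeq j ≤ Real.exp 1 ^ 2 / 4 := fun j hj => by
    obtain ⟨i, rfl⟩ := Nat.exists_eq_add_of_le' (show 1 ≤ j by omega)
    rw [← h2]
    exact Stirling.stirlingSeq'_antitone (show 1 ≤ i by omega)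
  have hpi : (1.7719 : ℝ) ≤ √Real.pi :=
    Real.le_sqrt_of_sq_le (by have := Real.pi_gt_d4; norm_num at this ⊢; linarith)
  have he : Real.exp 1 ^ 2 / 4 ≤ 1.8474 := by
    have := Real.exp_one_lt_d9
    have := Real.exp_pos 1
    nlinarith
  have h0 : ∀ j, 0 ≤ Stirling.stirlingSeq j := fun j => by
    unfold Stirling.stirlingSeq; positivity
  calc Stirling.stirlingSeq k * Stirling.stirlingSeq m ≤ 1.8474 * 1.8474 :=
        mul_le_mul ((key k hk).trans he) ((key m hm).trans he) (h0 m) (by norm_num)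
    _ ≤ 2 * 1.7719 := by norm_num
    _ ≤ _ := by linarith [Stirling.sqrt_pi_le_stirlingSeq hn]

theorem pow_le_choose_mul_sqrt {k m : ℕ} (h : k + m ≠ 0) :
    ((k : ℝ) + m) ^ (k + m) ≤
      (k + m).choose k * (k : ℝ) ^ k * (m : ℝ) ^ m * √(2 * (k + m)) := by
  have hone : 1 ≤ √(2 * ((k : ℝ) + m)) := by
    have : (1 : ℝ) ≤ k + m := by exact_mod_cast Nat.one_le_iff_ne_zero.2 h
    exact Real.le_sqrt_of_sq_le (by linarith)
  obtain rfl | rfl | ⟨hk, hm⟩ : k = 0 ∨ m = 0 ∨ (1 ≤ k ∧ 1 ≤ m) := by omega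
  · simp only [CharP.cast_eq_zero, zero_add] at hone ⊢
    simpa using le_mul_of_one_le_right (by positivity) hone
  · simp only [CharP.cast_eq_zero, add_zero] at hone ⊢
    simpa using le_mul_of_one_le_right (by positivity) hone
  obtain rfl | rfl | ⟨hk, hm⟩ : k = 1 ∨ m = 1 ∨ (2 ≤ k ∧ 2 ≤ m) := by omega
  · have := mul_le_mul_of_nonneg_left (succ_pow_le_pow_mul_sqrt hm)
      (show (0 : ℝ) ≤ m + 1 by positivity)
    simp only [Nat.cast_one, one_pow, mul_one, Nat.choose_one_right, Nat.cast_add]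
    rw [add_comm 1 m, add_comm 1 (m : ℝ), pow_succ]
    linarith
  · have := mul_le_mul_of_nonneg_left (succ_pow_le_pow_mul_sqrt hk)
      (show (0 : ℝ) ≤ k + 1 by positivity)
    simp only [Nat.cast_one, one_pow, mul_one, Nat.choose_succ_self_right, Nat.cast_add]
    rw [pow_succ]
    linarith
  have hfac : ∀ j : ℕ, j ≠ 0 → (j.factorial : ℝ) * Real.exp 1 ^ j =
      Stirling.stirlingSeq j * √(2 * j) * (j : ℝ) ^ j := fun j hj => by
    have : (0 : ℝ) < j := by positivity
    rw [Stirling.stirlingSeq, div_pow]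
    field_simp
  have hs : √(2 * k) * √(2 * m) ≤ (k : ℝ) + m := by
    have h1 := Real.sq_sqrt (show (0 : ℝ) ≤ 2 * k by positivity)
    have h2 := Real.sq_sqrt (show (0 : ℝ) ≤ 2 * m by positivity)
    nlinarith [sq_nonneg (√(2 * (k : ℝ)) - √(2 * m))]
  have hc : ((k + m).choose k : ℝ) * (k.factorial * m.factorial) = (k + m).factorial := by
    rw [← Nat.add_choose_mul_factorial_mul_factorial k m, Nat.choose_symm_add]
    push_cast
    ring
  have h0 : ∀ j, 0 ≤ Stirling.stirlingSeq j := fun j => by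
    unfold Stirling.stirlingSeq; positivity
  have hk' := hfac k (by omega)
  have hm' := hfac m (by omega)
  have hn' := hfac (k + m) h
  push_cast at hn'
  have hse : √(2 * ((k : ℝ) + m)) ^ 2 = 2 * ((k : ℝ) + m) := Real.sq_sqrt (by positivity)
  have hpos : 0 < (k.factorial : ℝ) * m.factorial * Real.exp 1 ^ (k + m) := by positivity
  refine le_of_mul_le_mul_left ?_ hpos
  calc (k.factorial : ℝ) * m.factorial * Real.exp 1 ^ (k + m) * ((k : ℝ) + m) ^ (k + m)
      = (Stirling.stirlingSeq k * Stirling.stirlingSeq m) * (√(2 * k) * √(2 * m)) *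
          ((k : ℝ) ^ k * (m : ℝ) ^ m * ((k : ℝ) + m) ^ (k + m)) := by
        rw [pow_add (Real.exp 1)]
        linear_combination ((k : ℝ) + m) ^ (k + m) * (m.factorial * Real.exp 1 ^ m) * hk' +
          ((k : ℝ) + m) ^ (k + m) * (Stirling.stirlingSeq k * √(2 * k) * (k : ℝ) ^ k) * hm'
    _ ≤ (2 * Stirling.stirlingSeq (k + m)) * ((k : ℝ) + m) *
          ((k : ℝ) ^ k * (m : ℝ) ^ m * ((k : ℝ) + m) ^ (k + m)) := by
        refine mul_le_mul_of_nonneg_right ?_ (by positivity)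
        exact mul_le_mul (stirlingSeq_mul_le h hk hm) hs (by positivity)
          (mul_nonneg zero_le_two (h0 _))
    _ = _ := by
        linear_combination -(Stirling.stirlingSeq (k + m) * ((k : ℝ) + m) ^ (k + m) *
          (k : ℝ) ^ k * (m : ℝ) ^ m) * hse -
          (√(2 * ((k : ℝ) + m)) * (k : ℝ) ^ k * (m : ℝ) ^ m) * hn' -
          (Real.exp 1 ^ (k + m) * √(2 * ((k : ℝ) + m)) * (k : ℝ) ^ k * (m : ℝ) ^ m) * hc

theorem binEntropy_mul_sub_mul_reflect {p x : ℝ} (hp0 : 0 < p) (hp1 : p < 1) (hx0 : 0 ≤ x)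
    (hx : x ≤ 1 / 2) :
    Real.binEntropy (p * (1 - x)) - (1 - x) * Real.binEntropy p ≤
      Real.binEntropy (p * x) - x * Real.binEntropy p := by
  set D : ℝ → ℝ := fun x => Real.binEntropy (p * x) - Real.binEntropy (p * (1 - x)) +
    (1 - 2 * x) * Real.binEntropy p with hD
  have hconc : ConcaveOn ℝ (Set.Icc 0 (1 / 2)) D := by
    refine concaveOn_of_hasDerivWithinAt2_nonpos (convex_Icc _ _)
      (f' := fun x => p * (Real.log (1 - p * x) - Real.log (p * x)) +
        p * (Real.log (1 - p * (1 - x)) - Real.log (p * (1 - x))) - 2 * Real.binEntropy p)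
      (f'' := fun x => -p / (x * (1 - p * x)) + p / ((1 - x) * (1 - p * (1 - x))))
      (by fun_prop) ?_ ?_ ?_
    all_goals
      intro x hx
      rw [interior_Icc] at hx
      obtain ⟨hx0, hx1⟩ := hx
      have a0 : 0 < p * x := by positivity
      have a1 : 0 < 1 - p * x := by nlinarith
      have b0 : 0 < p * (1 - x) := mul_pos hp0 (by linarith)
      have b1 : 0 < 1 - p * (1 - x) := by nlinarith
      have x1 : 0 < 1 - x := by linarith
      have da : HasDerivAt (fun x => p * x) p x := by simpa using (hasDerivAt_id x).const_mul p
      have db : HasDerivAt (fun x => p * (1 - x)) (-p) x := by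
        simpa using ((hasDerivAt_id x).const_sub 1).const_mul p
    · apply HasDerivAt.hasDerivWithinAt
      have h1 := (Real.hasDerivAt_binEntropy (p := p * x) a0.ne' (by linarith)).comp x da
      have h2 := (Real.hasDerivAt_binEntropy (p := p * (1 - x)) b0.ne' (by linarith)).comp x db
      have h3 : HasDerivAt (fun x => (1 - 2 * x) * Real.binEntropy p) (-2 * Real.binEntropy p) x := by
        simpa using (((hasDerivAt_id x).const_mul 2).const_sub 1).mul_const (Real.binEntropy p)
      refine ((h1.sub h2).add h3).congr_deriv ?_
      ring
    · apply HasDerivAt.hasDerivWithinAt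
      have h1 := (((da.const_sub 1).log a1.ne').sub (da.log a0.ne')).const_mul p
      have h2 := (((db.const_sub 1).log b1.ne').sub (db.log b0.ne')).const_mul p
      refine ((h1.add h2).sub_const (2 * Real.binEntropy p)).congr_deriv ?_
      field_simp
      ring
    · rw [neg_div, neg_add_nonpos_iff]
      refine div_le_div_of_nonneg_left hp0.le (by positivity) ?_
      nlinarith
  have h0 : D 0 = 0 := by simp [hD]
  have h1 : D (1 / 2) = 0 := by simp only [hD]; ring_nf
  have hnn := hconc.2 (x := 0) (y := 1 / 2) (by norm_num) (by norm_num)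
    (show (0 : ℝ) ≤ 1 - 2 * x by linarith) (show (0 : ℝ) ≤ 2 * x by linarith) (by ring)
  rw [h0, h1] at hnn
  simp only [smul_eq_mul, mul_zero, add_zero, zero_add] at hnn
  rw [show 2 * x * (1 / 2) = x by ring] at hnn
  simp only [hD] at hnn
  linarith

theorem binEntropy_mul_sub_mul_le {p ε x : ℝ} (hp0 : 0 < p) (hp1 : p < 1) (hε0 : 0 ≤ ε)
    (hε : ε ≤ 1 / 2) (hx0 : ε ≤ x) (hx1 : x ≤ 1 - ε) :
    Real.binEntropy (p * (1 - ε)) - (1 - ε) * Real.binEntropy p ≤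
      Real.binEntropy (p * x) - x * Real.binEntropy p := by
  obtain ⟨a, b, ha, hb, hab, rfl⟩ : ∃ a b : ℝ, 0 ≤ a ∧ 0 ≤ b ∧ a + b = 1 ∧
      a * ε + b * (1 - ε) = x := by
    have hs : x ∈ segment ℝ ε (1 - ε) := by
      rw [segment_eq_Icc (by linarith)]
      exact ⟨hx0, hx1⟩
    simpa [segment] using hs
  have hc := Real.strictConcave_binEntropy.concaveOn.2 (x := p * ε) (y := p * (1 - ε))
    ⟨by positivity, by nlinarith⟩ ⟨mul_nonneg hp0.le (by linarith), by nlinarith⟩ ha hb hab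
  have hr := binEntropy_mul_sub_mul_reflect hp0 hp1 hε0 hε
  simp only [smul_eq_mul] at hc
  rw [show a * (p * ε) + b * (p * (1 - ε)) = p * (a * ε + b * (1 - ε)) by ring] at hc
  obtain rfl : b = 1 - a := by linarith
  nlinarith [mul_le_mul_of_nonneg_left hr ha]

theorem qaryEntropy_one_sub_one_div {q : ℕ} (hq : 2 ≤ q) :
    Real.qaryEntropy q (1 - 1 / q) = Real.log q := by
  have h2 : (2 : ℝ) ≤ q := by exact_mod_cast hq
  have e : (1 : ℝ) - 1 / q = (q - 1) / q := by field_simp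
  rw [Real.qaryEntropy, Real.binEntropy_eq_negMulLog_add_negMulLog_one_sub, Real.negMulLog,
    Real.negMulLog, sub_sub_cancel, e, Real.log_div (by linarith) (by linarith), one_div,
    Real.log_inv]
  push_cast
  field_simp
  ring

theorem exp_mul_log_inv_div_mul_pow_self (k : ℕ) {x : ℝ} (hx : 0 < x) :
    Real.exp (x * (k / x * Real.log (k / x)⁻¹)) * (k : ℝ) ^ k = x ^ k := by
  obtain rfl | hk := Nat.eq_zero_or_pos k
  · simp
  have hk' : (0 : ℝ) < k := by exact_mod_cast hk
  rw [← mul_assoc, mul_div_cancel₀ _ hx.ne', Real.exp_nat_mul, Real.exp_log (by positivity),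
    ← mul_pow]
  congr 1
  field_simp

theorem exp_mul_qaryEntropy_le_choose {q k m : ℕ} (hq : 2 ≤ q) (h : k + m ≠ 0) :
    Real.exp (((k : ℝ) + m) * Real.qaryEntropy q (k / (k + m))) ≤
      (k + m).choose k * ((q : ℝ) - 1) ^ k * √(2 * (k + m)) := by
  have hn : (0 : ℝ) < k + m := by exact_mod_cast Nat.pos_of_ne_zero h
  have hq1 : (0 : ℝ) < q - 1 := by
    have : (2 : ℝ) ≤ q := by exact_mod_cast hq
    linarith
  have hpos : ∀ j : ℕ, 0 < (j : ℝ) ^ j := fun j => by exact_mod_cast Nat.pow_self_pos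
  refine le_of_mul_le_mul_right ?_ (mul_pos (hpos k) (hpos m))
  have e : (1 : ℝ) - k / (k + m) = m / (k + m) := by field_simp; ring
  have hexp : Real.exp (((k : ℝ) + m) * Real.qaryEntropy q (k / (k + m))) =
      ((q : ℝ) - 1) ^ k * (Real.exp ((k + m) * (k / (k + m) * Real.log (k / (k + m) : ℝ)⁻¹)) *
        Real.exp ((k + m) * (m / (k + m) * Real.log (m / (k + m) : ℝ)⁻¹))) := by
    nth_rewrite 1 [← Real.exp_log hq1]
    rw [← Real.exp_add, ← Real.exp_nat_mul, ← Real.exp_add, Real.qaryEntropy, Real.binEntropy, e]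
    congr 1
    push_cast
    field_simp
  calc _ = ((q : ℝ) - 1) ^ k * ((k : ℝ) + m) ^ (k + m) := by
        rw [hexp, pow_add, ← exp_mul_log_inv_div_mul_pow_self k hn,
          ← exp_mul_log_inv_div_mul_pow_self m hn]
        ring
    _ ≤ ((q : ℝ) - 1) ^ k *
          ((k + m).choose k * (k : ℝ) ^ k * (m : ℝ) ^ m * √(2 * (k + m))) := by
        gcongr
        exact pow_le_choose_mul_sqrt h
    _ = _ := by ring

/-- Below the mode, a Hamming ball is at least as large as predicted by the `q`-ary entropy, up to
a factor `√(2n)`. -/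
theorem exp_mul_qaryEntropy_le_hammingBallCard {q n t : ℕ} {θ : ℝ} (hq : 2 ≤ q) (hn : n ≠ 0)
    (hθ0 : 0 ≤ θ) (hθ : θ * n ≤ t) (ht : (t : ℝ) ≤ (1 - 1 / q) * n) :
    Real.exp (n * Real.qaryEntropy q θ) ≤ hammingBallCard q n t * √(2 * n) := by
  have hn' : (0 : ℝ) < n := by positivity
  have hq0 : (0 : ℝ) < q := by positivity
  have htn : t ≤ n := by
    have : (0 : ℝ) ≤ 1 / q := by positivity
    exact_mod_cast (show (t : ℝ) ≤ n by nlinarith)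
  obtain ⟨m, rfl⟩ := Nat.exists_eq_add_of_le htn
  have h1 : θ ≤ t / ((t + m : ℕ) : ℝ) := by rwa [le_div_iff₀ hn']
  have h2 : t / ((t + m : ℕ) : ℝ) ≤ 1 - 1 / q := by rwa [div_le_iff₀ hn']
  have hmono := (Real.qaryEntropy_strictMonoOn hq).monotoneOn ⟨hθ0, h1.trans h2⟩
    ⟨hθ0.trans h1, h2⟩ h1
  have hch := exp_mul_qaryEntropy_le_choose hq hn
  calc _ ≤ Real.exp (((t + m : ℕ) : ℝ) * Real.qaryEntropy q (t / ((t + m : ℕ) : ℝ))) := by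
        gcongr
    _ ≤ (t + m).choose t * ((q : ℝ) - 1) ^ t * √(2 * (t + m)) := by
        simpa only [Nat.cast_add] using hch
    _ ≤ _ := by
        rw [Nat.cast_add]
        gcongr
        have := choose_mul_le_hammingBallCard q (t + m) t
        rw [← @Nat.cast_le ℝ] at this
        rwa [Nat.cast_mul, Nat.cast_pow, Nat.cast_sub (by omega), Nat.cast_one] at this

theorem sq_le_three_pow {r : ℕ} (hr : 2 ≤ r) : (r + 1) ^ 2 ≤ 3 ^ r := by
  induction r, hr using Nat.le_induction with
  | base => norm_num
  | succ r hr ih =>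
    rw [pow_succ 3]
    nlinarith

theorem eq_two_of_pow_lt_pow {q n N : ℕ} (hq : 2 ≤ q) (hqn : q < n)
    (h1 : 2 * n * (q - 1) ^ 2 < N ^ 2) (h2 : N ^ (q - 1) < q ^ q) : q = 2 := by
  by_contra hne
  obtain ⟨r, rfl⟩ := Nat.exists_eq_add_of_le' (show 1 ≤ q by omega)
  rw [Nat.add_sub_cancel] at h1 h2
  have hr : 2 ≤ r := by omega
  have h3 : 3 * (r + 1) ^ 2 ≤ N ^ 2 := by nlinarith [sq_nonneg r, Nat.mul_le_mul hr hr]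
  have h4 : (3 * (r + 1) ^ 2) ^ r ≤ (N ^ 2) ^ r := Nat.pow_le_pow_left h3 r
  have h5 : (N ^ r) ^ 2 < ((r + 1) ^ (r + 1)) ^ 2 := Nat.pow_lt_pow_left h2 two_ne_zero
  have h6 := Nat.mul_le_mul_right (((r + 1) ^ 2) ^ r) (sq_le_three_pow hr)
  rw [mul_pow] at h4
  have e1 : (N ^ r) ^ 2 = (N ^ 2) ^ r := by rw [← pow_mul, ← pow_mul, mul_comm]
  have e2 : ((r + 1) ^ (r + 1)) ^ 2 = (r + 1) ^ 2 * ((r + 1) ^ 2) ^ r := by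
    rw [← pow_succ', ← pow_mul, ← pow_mul, mul_comm]
  omega

/-- A code too small for its list-decoding radius to lie below the mode of the Hamming spheres
still has list size at least `N / √(2n)`. -/
theorem pow_le_hammingBallCard_mul_sqrt {q n t N L : ℕ} (hq : 2 ≤ q) (hn : n ≠ 0)
    (hL : q - 1 ≤ L) (ht : (1 - 1 / q) * (n : ℝ) < t) (hLN : L * √(2 * n) < N)
    (hN : N ^ (q - 1) < q ^ q) :
    (q : ℝ) ^ n ≤ hammingBallCard q n t * √(2 * n) := by
  have hn1 : (1 : ℝ) ≤ n := by exact_mod_cast Nat.one_le_iff_ne_zero.2 hn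
  have hsqrt : 1 ≤ √(2 * (n : ℝ)) := Real.le_sqrt_of_sq_le (by linarith)
  obtain htn | htn := le_or_gt n t
  · have := hammingBallCard_mono q n htn
    rw [hammingBallCard_self (by omega)] at this
    have h' : (q : ℝ) ^ n ≤ hammingBallCard q n t := by exact_mod_cast this
    exact h'.trans (le_mul_of_one_le_right (Nat.cast_nonneg _) hsqrt)
  have hq0 : (0 : ℝ) < q := by positivity
  have htn' : (t : ℝ) + 1 ≤ n := by exact_mod_cast htn
  have hqn : q < n := by
    rw [one_sub_mul, one_div_mul_eq_div] at ht
    have : 1 < (n : ℝ) / q := by linarith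
    rw [lt_div_iff₀ hq0, one_mul] at this
    exact_mod_cast this
  have h1 : 2 * n * L ^ 2 < N ^ 2 := by
    have := pow_lt_pow_left₀ hLN (by positivity) two_ne_zero
    rw [mul_pow, Real.sq_sqrt (by positivity)] at this
    have h' : ((L ^ 2 * (2 * n) : ℕ) : ℝ) < ((N ^ 2 : ℕ) : ℝ) := by push_cast; exact this
    rw [mul_comm]
    exact_mod_cast h'
  have hq2 : q = 2 := eq_two_of_pow_lt_pow hq hqn
    (lt_of_le_of_lt (Nat.mul_le_mul_left _ (Nat.pow_le_pow_left hL 2)) h1) hN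
  subst hq2
  have hN4 : N < 4 := by simpa using hN
  have hn4 : n ≤ 4 := by
    have : 1 ≤ L ^ 2 := Nat.one_le_pow _ _ (by omega)
    nlinarith
  have h2t : n < 2 * t := by
    have : (n : ℝ) < 2 * t := by push_cast at ht; linarith
    exact_mod_cast this
  have hs2 : (2 : ℝ) ≤ √(2 * n) :=
    Real.le_sqrt_of_sq_le (by have : (2 : ℝ) < n := by exact_mod_cast hqn
                              linarith)
  have hV : 2 ^ n ≤ hammingBallCard 2 n t * 2 := by
    obtain ⟨rfl, rfl⟩ | ⟨rfl, rfl⟩ : n = 3 ∧ t = 2 ∨ n = 4 ∧ t = 3 := by omega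
    all_goals decide
  calc ((2 : ℕ) : ℝ) ^ n ≤ hammingBallCard 2 n t * 2 := by exact_mod_cast hV
    _ ≤ _ := by gcongr

theorem ListDecodable.ncard_mul_hammingBallCard_le {F ι : Type*} [Field F] [Fintype F]
    [DecidableEq F] [Fintype ι] [DecidableEq ι] {C : Set (ι → F)} {τ L : ℕ}
    (h : ListDecodable C τ L) :
    C.ncard * hammingBallCard (Fintype.card F) (Fintype.card ι) τ ≤
      Fintype.card F ^ Fintype.card ι * L := by
  classical
  have hC : C.ncard = C.toFinset.card := Set.ncard_eq_toFinset_card' C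
  calc C.ncard * hammingBallCard (Fintype.card F) (Fintype.card ι) τ
      = ∑ c ∈ C.toFinset, (Finset.univ.filter fun y : ι → F => hammingDist y c ≤ τ).card := by
        simp [card_hammingDist_le, hC]
    _ = ∑ y : ι → F, (C.toFinset.filter fun c => hammingDist y c ≤ τ).card :=
        (Finset.sum_card_bipartiteAbove_eq_sum_card_bipartiteBelow
          (fun (c y : ι → F) => hammingDist y c ≤ τ))
    _ ≤ ∑ _y : ι → F, L := by
        refine Finset.sum_le_sum fun y _ => ?_
        refine le_of_eq_of_le ?_ (h y)
        rw [← Set.ncard_coe_finset]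
        congr 1
        ext c
        simp
    _ = _ := by simp

theorem binEnt_eq_binEntropy_div (x : ℝ) : binEnt x = Real.binEntropy x / Real.log 2 := by
  rw [binEnt, Real.binEntropy, Real.log_inv, Real.log_inv, Real.logb, Real.logb]
  ring

theorem two_rpow_etaQ_mul {q : ℕ} (hq : q ≠ 0) (ε y : ℝ) :
    (2 : ℝ) ^ (etaQ q ε * y) = Real.exp (y * (Real.binEntropy ((1 - 1 / q) * (1 - ε)) -
      (1 - ε) * Real.binEntropy (1 - 1 / q))) := by
  have hq' : (q : ℝ) ≠ 0 := by exact_mod_cast hq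
  have hlog : Real.log 2 ≠ 0 := (Real.log_pos one_lt_two).ne'
  rw [Real.rpow_def_of_pos two_pos, etaQ, binEnt_eq_binEntropy_div, binEnt_eq_binEntropy_div,
    Real.binEntropy_one_sub, show ((q : ℝ) - 1) / q = 1 - 1 / q by field_simp]
  congr 1
  field_simp

theorem binEntropy_mul_sub_mul_eq {q : ℕ} (hq : 2 ≤ q) (x : ℝ) :
    Real.binEntropy ((1 - 1 / q) * x) - x * Real.binEntropy (1 - 1 / q) =
      Real.qaryEntropy q ((1 - 1 / q) * x) - x * Real.log q := by
  rw [← qaryEntropy_one_sub_one_div hq, Real.qaryEntropy, Real.qaryEntropy]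
  ring

/-- Lemma `L<q-1`: fix `ε ∈ (0, 1/2]`.  If a code
`C ⊆ GF(q)^n` of rate `R = log_q |C| / n ∈ [ε, 1-ε]` is `(τ,L)`-list
decodable, where `L < 2^{η_q(ε) n} / √(2n)` and `τ ≥ L n (1-R)/(L+1)`, then
`L < q - 1`. -/
theorem stmt11 {F : Type*} [Field F] [Fintype F] [DecidableEq F]
    {n L τ : ℕ} (ε : ℝ) (hε0 : 0 < ε) (hε : ε ≤ 1 / 2)
    (C : Set (Fin n → F)) (hCne : C.Nonempty)
    (hR1 : ε ≤ Real.logb (Fintype.card F) (C.ncard) / n)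
    (hR2 : Real.logb (Fintype.card F) (C.ncard) / n ≤ 1 - ε)
    (hL : 1 ≤ L)
    (hLub : (L : ℝ) <
      (1 / Real.sqrt (2 * n)) * (2 : ℝ) ^ (etaQ (Fintype.card F) ε * n))
    (hτ : (L : ℝ) * n * (1 - Real.logb (Fintype.card F) (C.ncard) / n) /
        ((L : ℝ) + 1) ≤ (τ : ℝ))
    (hdec : ListDecodable C τ L) :
    (L : ℝ) < (Fintype.card F : ℝ) - 1 := by
  by_contra! hcon
  set q := Fintype.card F
  set N := C.ncard
  have hq : 2 ≤ q := Fintype.one_lt_card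
  have hq2 : (2 : ℝ) ≤ q := by exact_mod_cast hq
  have hn : n ≠ 0 := by
    rintro rfl
    simp at hR1
    linarith
  have hn0 : (0 : ℝ) < n := by positivity
  have hNpos : (0 : ℝ) < N := by exact_mod_cast (Set.ncard_pos (Set.toFinite C)).2 hCne
  have hlogq : 0 < Real.log q := Real.log_pos (by linarith)
  set R : ℝ := Real.logb q N / n with hR
  have hNlog : n * R * Real.log q = Real.log N := by
    rw [hR, Real.logb]
    field_simp
  have hp0 : (0 : ℝ) < 1 - 1 / q := by
    rw [sub_pos, div_lt_one (by linarith)]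
    linarith
  have hp1 : (1 : ℝ) - 1 / q < 1 := by
    rw [sub_lt_self_iff]
    positivity
  have hsq : 0 < √(2 * (n : ℝ)) := by positivity
  have hLN : q - 1 ≤ L := by
    have : (q : ℝ) ≤ (L + 1 : ℕ) := by push_cast; linarith
    have : q ≤ L + 1 := by exact_mod_cast this
    omega
  -- upper bound on the list size in terms of the entropy at the rate of the code
  have hLup : L * √(2 * n) * (q : ℝ) ^ n <
      Real.exp (n * Real.qaryEntropy q ((1 - 1 / q) * (1 - R))) * N := by
    rw [two_rpow_etaQ_mul (by omega), one_div_mul_eq_div, lt_div_iff₀ hsq] at hLub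
    have hmono := binEntropy_mul_sub_mul_le hp0 hp1 hε0.le hε (x := 1 - R) (by linarith)
      (by linarith)
    rw [binEntropy_mul_sub_mul_eq hq (1 - R)] at hmono
    have hlt := hLub.trans_le (Real.exp_le_exp.2 (mul_le_mul_of_nonneg_left hmono hn0.le))
    have hqn : (q : ℝ) ^ n = Real.exp (n * Real.log q) := by
      rw [Real.exp_nat_mul, Real.exp_log (by linarith)]
    calc _ < _ := mul_lt_mul_of_pos_right hlt (by positivity)
      _ = _ := by
        have hNexp : (N : ℝ) = Real.exp (n * R * Real.log q) := by rw [hNlog, Real.exp_log hNpos]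
        rw [hqn, ← Real.exp_add]
        refine Eq.trans ?_ (congrArg _ hNexp.symm)
        rw [← Real.exp_add]
        congr 1
        ring
  have hθ0 : 0 ≤ (1 - 1 / (q : ℝ)) * (1 - R) := mul_nonneg hp0.le (by linarith)
  have hθp : (1 - 1 / (q : ℝ)) * (1 - R) ≤ 1 - 1 / q := by nlinarith
  have hexp_le : Real.exp (n * Real.qaryEntropy q ((1 - 1 / q) * (1 - R))) ≤ (q : ℝ) ^ n := by
    rw [Real.exp_nat_mul]
    gcongr
    rw [← Real.le_log_iff_exp_le (by linarith), ← qaryEntropy_one_sub_one_div hq]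
    exact (Real.qaryEntropy_strictMonoOn hq).monotoneOn ⟨hθ0, hθp⟩ ⟨hp0.le, le_rfl⟩ hθp
  set t := ⌈(1 - 1 / (q : ℝ)) * (1 - R) * n⌉₊ with ht
  have htτ : t ≤ τ := by
    rw [ht, Nat.ceil_le]
    refine le_trans ?_ hτ
    rw [mul_div_right_comm, mul_div_right_comm]
    have : 1 - 1 / (q : ℝ) ≤ L / (L + 1) := by
      rw [one_sub_div (by linarith), div_le_div_iff₀ (by linarith) (by positivity)]
      linarith
    calc _ = (1 - 1 / (q : ℝ)) * (n * (1 - R)) := by ring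
      _ ≤ L / (L + 1) * (n * (1 - R)) :=
        mul_le_mul_of_nonneg_right this (mul_nonneg hn0.le (by linarith))
      _ = _ := by ring
  have hV : (N : ℝ) * hammingBallCard q n t ≤ (q : ℝ) ^ n * L := by
    have h := hdec.ncard_mul_hammingBallCard_le
    rw [Fintype.card_fin] at h
    exact_mod_cast (Nat.mul_le_mul_left _ (hammingBallCard_mono q n htτ)).trans h
  have hVlt : hammingBallCard q n t * √(2 * n) <
      Real.exp (n * Real.qaryEntropy q ((1 - 1 / q) * (1 - R))) := by
    refine lt_of_mul_lt_mul_right ?_ hNpos.le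
    calc _ = (N : ℝ) * hammingBallCard q n t * √(2 * n) := by ring
      _ ≤ (q : ℝ) ^ n * L * √(2 * n) := by gcongr
      _ = L * √(2 * n) * (q : ℝ) ^ n := by ring
      _ < _ := hLup
  obtain hle | hgt := le_or_gt (t : ℝ) ((1 - 1 / q) * n)
  · exact hVlt.not_ge (exp_mul_qaryEntropy_le_hammingBallCard hq hn hθ0 (Nat.le_ceil _) hle)
  · refine (hVlt.trans_le hexp_le).not_ge
      (pow_le_hammingBallCard_mul_sqrt (L := L) (N := N) hq hn hLN hgt ?_ ?_)
    · refine lt_of_mul_lt_mul_right (hLup.trans_le ?_)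
        (show (0 : ℝ) ≤ (q : ℝ) ^ n by positivity)
      rw [mul_comm (N : ℝ)]
      gcongr
    · have hceil := Nat.ceil_lt_add_one (mul_nonneg hθ0 hn0.le)
      rw [← ht] at hceil
      have hRn : (1 - 1 / (q : ℝ)) * (n * R) < 1 := by nlinarith
      have hRq : ((q : ℝ) - 1) * (n * R) < q := by
        rw [one_sub_div (by linarith), div_mul_eq_mul_div, div_lt_one (by linarith)] at hRn
        exact hRn
      have hlt : Real.log ((N : ℝ) ^ (q - 1)) < Real.log ((q : ℝ) ^ q) := by
        rw [Real.log_pow, Real.log_pow, ← hNlog, Nat.cast_sub (by omega), Nat.cast_one]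
        nlinarith
      exact_mod_cast (Real.log_lt_log_iff (by positivity) (by positivity)).1 hlt
end
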